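/- Assume the homogeneous permutation relation D₁ R M₁ R = R M₁ R⁻¹ D₁ holds (so that products of the matrices D and M in A are already normally ordered). Set L̂ = MD. Then for every k ≥ 1: L̂_{⟨1→k⟩} = M_{⟨1→k⟩} · D_{⟨k→1⟩} · (∏_{s=1}^{k} J_s⁻¹) = (∏_{s=1}^{k} J_s⁻¹) · M_{⟨1→k⟩} · D_{⟨k→1⟩}, where L̂_{⟨1→k⟩} = L̂_{⟨1⟩}L̂_{⟨2⟩}⋯L̂_{⟨k⟩}, M_{⟨1→k⟩} = M_{⟨1⟩}⋯M_{⟨k⟩} and D_{⟨k→1⟩} = D_{⟨k⟩}D_{⟨k−1⟩}⋯D_{⟨1⟩}. In the quantum double this identity gives the normally ordered form :L̂_{⟨1→k⟩}:. -/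

import Mathlib

open scoped BigOperators

noncomputable section

/-- One-site embedding of an `N×N` matrix into `Mat_{N^k}` at 0-based position `i`
(the paper's `X_{i+1}` in 1-based numbering).  Out of range we return the identity. -/
def matAt {α : Type*} [Semiring α] (N k : ℕ) (X : Matrix (Fin N) (Fin N) α) (i : ℕ) :
    Matrix (Fin k → Fin N) (Fin k → Fin N) α :=
  if h : i < k then
    Matrix.of fun a b =>
      if ∀ l : Fin k, (l : ℕ) ≠ i → a l = b l then X (a ⟨i, h⟩) (b ⟨i, h⟩) else 0
  else 1

/-- Two-site embedding of an operator on `V⊗V` into `Mat_{N^k}` at 0-based positions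
`i, i+1` (the paper's `R_{i+1}` in 1-based numbering). -/
def opAt {α : Type*} [Semiring α] (N k : ℕ)
    (R : Matrix (Fin N × Fin N) (Fin N × Fin N) α) (i : ℕ) :
    Matrix (Fin k → Fin N) (Fin k → Fin N) α :=
  if h : i + 1 < k then
    Matrix.of fun a b =>
      if ∀ l : Fin k, (l : ℕ) ≠ i → (l : ℕ) ≠ i + 1 → a l = b l then
        R (a ⟨i, by omega⟩, a ⟨i + 1, h⟩) (b ⟨i, by omega⟩, b ⟨i + 1, h⟩)
      else 0
  else 1

/-- A numeric (complex) matrix viewed inside `Mat(A)` via the unit of `A`. -/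
def toA (A : Type*) [Semiring A] [Algebra ℂ A] {ι : Type*} (X : Matrix ι ι ℂ) :
    Matrix ι ι A :=
  X.map (algebraMap ℂ A)

/-- The braid relation `R₁R₂R₁ = R₂R₁R₂` on `V^{⊗3}`. -/
def IsBraid (N : ℕ) (R : Matrix (Fin N × Fin N) (Fin N × Fin N) ℂ) : Prop :=
  opAt N 3 R 0 * opAt N 3 R 1 * opAt N 3 R 0 = opAt N 3 R 1 * opAt N 3 R 0 * opAt N 3 R 1

/-- The Hecke condition `(q·I − R)(q⁻¹·I + R) = 0`. -/
def IsHecke (N : ℕ) (q : ℂ) (R : Matrix (Fin N × Fin N) (Fin N × Fin N) ℂ) : Prop :=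
  (q • (1 : Matrix (Fin N × Fin N) (Fin N × Fin N) ℂ) - R) * (q⁻¹ • 1 + R) = 0

/-- `q` is generic: `q ∉ {0, 1, −1}` and `qⁿ ≠ 1` for all positive integers `n`. -/
def GenericQ (q : ℂ) : Prop :=
  q ≠ 0 ∧ q ≠ 1 ∧ q ≠ -1 ∧ ∀ n : ℕ, 0 < n → q ^ n ≠ 1

/-- The reflection-equation type relation `R X₁ R X₁ = X₁ R X₁ R` in `Mat_{N²}`. -/
def RErel {α : Type*} [Semiring α] (N : ℕ)
    (R : Matrix (Fin N × Fin N) (Fin N × Fin N) α) (X : Matrix (Fin N) (Fin N) α) : Prop :=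
  opAt N 2 R 0 * matAt N 2 X 0 * opAt N 2 R 0 * matAt N 2 X 0 =
    matAt N 2 X 0 * opAt N 2 R 0 * matAt N 2 X 0 * opAt N 2 R 0

/-- The quantum-double permutation relation `D₁ R M₁ R = R M₁ R⁻¹ D₁ + R` in `Mat_{N²}(A)`. -/
def PermRel {A : Type*} [Ring A] [Algebra ℂ A] (N : ℕ)
    (R Rinv : Matrix (Fin N × Fin N) (Fin N × Fin N) ℂ)
    (M D : Matrix (Fin N) (Fin N) A) : Prop :=
  matAt N 2 D 0 * opAt N 2 (toA A R) 0 * matAt N 2 M 0 * opAt N 2 (toA A R) 0 =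
    opAt N 2 (toA A R) 0 * matAt N 2 M 0 * opAt N 2 (toA A Rinv) 0 * matAt N 2 D 0 +
      opAt N 2 (toA A R) 0

/-- The homogeneous permutation relation `D₁ R M₁ R = R M₁ R⁻¹ D₁` in `Mat_{N²}(A)`. -/
def PermRelHom {A : Type*} [Ring A] [Algebra ℂ A] (N : ℕ)
    (R Rinv : Matrix (Fin N × Fin N) (Fin N × Fin N) ℂ)
    (M D : Matrix (Fin N) (Fin N) A) : Prop :=
  matAt N 2 D 0 * opAt N 2 (toA A R) 0 * matAt N 2 M 0 * opAt N 2 (toA A R) 0 =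
    opAt N 2 (toA A R) 0 * matAt N 2 M 0 * opAt N 2 (toA A Rinv) 0 * matAt N 2 D 0

/-- Overline copies: `ovCopy … r = X_{⟨r+1⟩}`, i.e. `X_{⟨1⟩} = X⊗I⊗⋯⊗I` and
`X_{⟨r+1⟩} = R_r X_{⟨r⟩} R_r⁻¹`. -/
def ovCopy {α : Type*} [Semiring α] (N k : ℕ)
    (R Rinv : Matrix (Fin N × Fin N) (Fin N × Fin N) α)
    (X : Matrix (Fin N) (Fin N) α) : ℕ → Matrix (Fin k → Fin N) (Fin k → Fin N) α
  | 0 => matAt N k X 0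
  | r + 1 => opAt N k R r * ovCopy N k R Rinv X r * opAt N k Rinv r

/-- Underline copies: `unCopy … r = X_{[r+1]}`, i.e. `X_{[1]} = X⊗I⊗⋯⊗I` and
`X_{[r+1]} = R_r⁻¹ X_{[r]} R_r`. -/
def unCopy {α : Type*} [Semiring α] (N k : ℕ)
    (R Rinv : Matrix (Fin N × Fin N) (Fin N × Fin N) α)
    (X : Matrix (Fin N) (Fin N) α) : ℕ → Matrix (Fin k → Fin N) (Fin k → Fin N) α
  | 0 => matAt N k X 0
  | r + 1 => opAt N k Rinv r * unCopy N k R Rinv X r * opAt N k R r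

/-- `X_{⟨1→n⟩} = X_{⟨1⟩}X_{⟨2⟩}⋯X_{⟨n⟩}`. -/
def ovProd {α : Type*} [Semiring α] (N k : ℕ)
    (R Rinv : Matrix (Fin N × Fin N) (Fin N × Fin N) α)
    (X : Matrix (Fin N) (Fin N) α) (n : ℕ) : Matrix (Fin k → Fin N) (Fin k → Fin N) α :=
  ((List.range n).map (ovCopy N k R Rinv X)).prod

/-- `X_{⟨n→1⟩} = X_{⟨n⟩}X_{⟨n−1⟩}⋯X_{⟨1⟩}`. -/
def ovProdRev {α : Type*} [Semiring α] (N k : ℕ)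
    (R Rinv : Matrix (Fin N × Fin N) (Fin N × Fin N) α)
    (X : Matrix (Fin N) (Fin N) α) (n : ℕ) : Matrix (Fin k → Fin N) (Fin k → Fin N) α :=
  ((List.range n).reverse.map (ovCopy N k R Rinv X)).prod

/-- Shifted Jucys–Murphy matrices: `JMup … R n s = J_{s+1}^{↑n}`, i.e. `J₁^{↑n} = I` and
`J_{s+1}^{↑n} = R_{n+s} J_s^{↑n} R_{n+s}` (paper's 1-based `R_{n+s}` is `opAt … (n+s-1)`).
Applying it to `R⁻¹` produces `(J_{s+1}^{↑n})⁻¹`. -/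
def JMup {α : Type*} [Semiring α] (N k : ℕ)
    (R : Matrix (Fin N × Fin N) (Fin N × Fin N) α) (n : ℕ) :
    ℕ → Matrix (Fin k → Fin N) (Fin k → Fin N) α
  | 0 => 1
  | s + 1 => opAt N k R (n + s) * JMup N k R n s * opAt N k R (n + s)

/-- The quantum trace `Tr_{R(1…n)}(X) = Tr(C₁C₂⋯C_n X)`. -/
def qTr {α : Type*} [Semiring α] (N n : ℕ) (C : Matrix (Fin N) (Fin N) α)
    (X : Matrix (Fin n → Fin N) (Fin n → Fin N) α) : α :=
  Matrix.trace (((List.range n).map (matAt N n C)).prod * X)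

/-- The matrix `C`, `C_i^j = Σ_k Ψ_{ik}^{jk}`. -/
def traceMat (N : ℕ) (Ψ : Matrix (Fin N × Fin N) (Fin N × Fin N) ℂ) :
    Matrix (Fin N) (Fin N) ℂ :=
  Matrix.of fun i j => ∑ k, Ψ (i, k) (j, k)

/-- Skew-invertibility of `R`: `Tr₂(R₁₂Ψ₂₃) = Tr₂(Ψ₁₂R₂₃) = P₁₃`, written componentwise. -/
def SkewInv (N : ℕ) (R Ψ : Matrix (Fin N × Fin N) (Fin N × Fin N) ℂ) : Prop :=
  (∀ i k l n : Fin N, ∑ j, ∑ b, R (i, j) (l, b) * Ψ (b, k) (j, n) =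
      if i = n ∧ k = l then 1 else 0) ∧
  (∀ i k l n : Fin N, ∑ j, ∑ b, Ψ (i, j) (l, b) * R (b, k) (j, n) =
      if i = n ∧ k = l then 1 else 0)

/-- The generators `R₁, …, R_{n−1}` (1-based) of the Hecke-algebra image inside
`End(V^{⊗k})`, as a subset of `Mat_{N^k}`. -/
def genSet {α : Type*} [Semiring α] (N k n : ℕ)
    (R : Matrix (Fin N × Fin N) (Fin N × Fin N) α) :
    Set (Matrix (Fin k → Fin N) (Fin k → Fin N) α) :=
  {X | ∃ i : ℕ, i + 1 < n ∧ X = opAt N k R i}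

/-- The left ideal of `A` generated by the entries of `D`. -/
def entryIdeal (A : Type*) [Ring A] {N : ℕ} (D : Matrix (Fin N) (Fin N) A) :
    Submodule A A :=
  Submodule.span A {x : A | ∃ i j : Fin N, x = D i j}

/-- The normally ordered monomial `:L̂_{⟨1→k⟩}: = M_{⟨1→k⟩} D_{⟨k→1⟩} ∏_{s=1}^{k} J_s⁻¹`. -/
def normOrd {α : Type*} [Semiring α] (N k : ℕ)
    (R Rinv : Matrix (Fin N × Fin N) (Fin N × Fin N) α)
    (M D : Matrix (Fin N) (Fin N) α) (n : ℕ) :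
    Matrix (Fin k → Fin N) (Fin k → Fin N) α :=
  ovProd N k R Rinv M n * ovProdRev N k R Rinv D n *
    ((List.range n).map (fun s => JMup N k Rinv 0 s)).prod

/-- The relations among the `R_i` and their inverses in `End(V^{⊗k})`; the braid relation holds
only as long as all the sites involved are among the `k` available ones. -/
structure BraidFamily {B : Type*} [Monoid B] (k : ℕ) (r s : ℕ → B) : Prop where
  mul_inv : ∀ i, r i * s i = 1
  inv_mul : ∀ i, s i * r i = 1
  far : ∀ i j, i + 2 ≤ j → Commute (r i) (r j)
  braid : ∀ i, i + 2 < k → r i * r (i + 1) * r i = r (i + 1) * r i * r (i + 1)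

/-- The copies `x_{⟨n+1⟩}` of `x` along a family `r` with inverses `s`. -/
def conjCopy {B : Type*} [Monoid B] (r s : ℕ → B) (x : B) : ℕ → B
  | 0 => x
  | n + 1 => r n * conjCopy r s x n * s n

/-- The Jucys–Murphy elements of a family `s`. -/
def jucysMurphy {B : Type*} [Monoid B] (s : ℕ → B) : ℕ → B
  | 0 => 1
  | n + 1 => s n * jucysMurphy s n * s n

/-- The product of the first `n` terms of `f`, in increasing order. -/
def ascProd {B : Type*} [Monoid B] (f : ℕ → B) (n : ℕ) : B := ((List.range n).map f).prod

/-- The product of the first `n` terms of `f`, in decreasing order. -/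
def descProd {B : Type*} [Monoid B] (f : ℕ → B) (n : ℕ) : B :=
  ((List.range n).reverse.map f).prod

section Products

variable {B : Type*} [Monoid B]

lemma ascProd_zero (f : ℕ → B) : ascProd f 0 = 1 := by simp [ascProd]

lemma ascProd_succ (f : ℕ → B) (n : ℕ) : ascProd f (n + 1) = ascProd f n * f n := by
  simp [ascProd, List.range_succ]

lemma descProd_zero (f : ℕ → B) : descProd f 0 = 1 := by simp [descProd]

lemma descProd_succ (f : ℕ → B) (n : ℕ) : descProd f (n + 1) = f n * descProd f n := by
  simp [descProd, List.range_succ]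

lemma commute_ascProd (f : ℕ → B) (z : B) (n : ℕ) (h : ∀ i < n, Commute z (f i)) :
    Commute z (ascProd f n) := by
  induction n with
  | zero => rw [ascProd_zero]; exact Commute.one_right z
  | succ n ih =>
    rw [ascProd_succ]
    exact (ih fun i hi => h i (by omega)).mul_right (h n (by omega))

lemma commute_descProd (f : ℕ → B) (z : B) (n : ℕ) (h : ∀ i < n, Commute z (f i)) :
    Commute z (descProd f n) := by
  induction n with
  | zero => rw [descProd_zero]; exact Commute.one_right z
  | succ n ih =>
    rw [descProd_succ]
    exact (h n (by omega)).mul_right (ih fun i hi => h i (by omega))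

/-- An element commuting with two neighbouring terms only through their product still commutes
with the whole increasing product. -/
lemma commute_ascProd_of_pair (f : ℕ → B) (z : B) (i n : ℕ) (hin : i + 1 < n)
    (hpair : Commute z (f i * f (i + 1)))
    (h : ∀ j < n, j ≠ i → j ≠ i + 1 → Commute z (f j)) : Commute z (ascProd f n) := by
  induction n, hin using Nat.le_induction with
  | base =>
    rw [ascProd_succ, ascProd_succ, mul_assoc]
    exact (commute_ascProd f z i fun j hj => h j (by omega) (by omega) (by omega)).mul_right hpair
  | succ n hn ih =>
    rw [ascProd_succ]
    exact (ih fun j hj => h j (by omega)).mul_right (h n (by omega) (by omega) (by omega))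

/-- An element commuting with two neighbouring terms only through their product still commutes
with the whole decreasing product. -/
lemma commute_descProd_of_pair (f : ℕ → B) (z : B) (i n : ℕ) (hin : i + 1 < n)
    (hpair : Commute z (f (i + 1) * f i))
    (h : ∀ j < n, j ≠ i → j ≠ i + 1 → Commute z (f j)) : Commute z (descProd f n) := by
  induction n, hin using Nat.le_induction with
  | base =>
    rw [descProd_succ, descProd_succ, ← mul_assoc]
    exact hpair.mul_right
      (commute_descProd f z i fun j hj => h j (by omega) (by omega) (by omega))
  | succ n hn ih =>
    rw [descProd_succ]
    exact (h n (by omega) (by omega) (by omega)).mul_right (ih fun j hj => h j (by omega))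

end Products

namespace BraidFamily

variable {B : Type*} [Monoid B] {k : ℕ} {r s : ℕ → B}

lemma isUnit (h : BraidFamily k r s) (i : ℕ) : IsUnit (r i) :=
  ⟨⟨r i, s i, h.mul_inv i, h.inv_mul i⟩, rfl⟩

lemma mul_inv_assoc (h : BraidFamily k r s) (i : ℕ) (z : B) : r i * (s i * z) = z := by
  rw [← mul_assoc, h.mul_inv, one_mul]

lemma inv_mul_assoc (h : BraidFamily k r s) (i : ℕ) (z : B) : s i * (r i * z) = z := by
  rw [← mul_assoc, h.inv_mul, one_mul]

/-- What `r i` commutes with, its inverse commutes with too. -/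
lemma commute_inv (h : BraidFamily k r s) {i : ℕ} {z : B} (hz : Commute (r i) z) :
    Commute (s i) z :=
  Commute.units_inv_left (u := ⟨r i, s i, h.mul_inv i, h.inv_mul i⟩) hz

lemma commute_of_inv (h : BraidFamily k r s) {i : ℕ} {z : B} (hz : Commute (s i) z) :
    Commute (r i) z :=
  Commute.units_inv_left (u := ⟨s i, r i, h.inv_mul i, h.mul_inv i⟩) hz

/-- The inverses of a braid family form a braid family. -/
lemma symm (h : BraidFamily k r s) : BraidFamily k s r where
  mul_inv := h.inv_mul
  inv_mul := h.mul_inv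
  far i j hij := h.commute_inv (h.commute_inv (h.far i j hij).symm).symm
  braid i hi := by
    refine left_inv_eq_right_inv (a := r i * r (i + 1) * r i) ?_ ?_
    · simp only [mul_assoc, h.inv_mul_assoc, h.inv_mul]
    · rw [h.braid i hi]
      simp only [mul_assoc, h.mul_inv_assoc, h.mul_inv]

lemma semiconj_mul (h : BraidFamily k r s) {i : ℕ} (hi : i + 2 < k) :
    SemiconjBy (r i * r (i + 1)) (r i) (r (i + 1)) := by
  rw [SemiconjBy, h.braid i hi, mul_assoc]

lemma semiconj_mul_inv (h : BraidFamily k r s) {i : ℕ} (hi : i + 2 < k) :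
    SemiconjBy (r i * r (i + 1)) (s i) (s (i + 1)) := by
  have := h.semiconj_mul hi
  exact SemiconjBy.units_inv_right (x := ⟨r i, s i, h.mul_inv i, h.inv_mul i⟩)
    (y := ⟨r (i + 1), s (i + 1), h.mul_inv _, h.inv_mul _⟩) this

lemma commute_conjCopy_of_lt (h : BraidFamily k r s) {x : B} (hx : ∀ i, 1 ≤ i → Commute (r i) x)
    {n i : ℕ} (hni : n < i) : Commute (r i) (conjCopy r s x n) := by
  induction n with
  | zero => exact hx i hni
  | succ n ih =>
    have hf : Commute (r i) (r n) := (h.far n i (by omega)).symm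
    exact (hf.mul_right (ih (by omega))).mul_right (h.commute_inv hf.symm).symm

lemma semiconj_conjCopy (h : BraidFamily k r s) {x : B} (hx : ∀ i, 1 ≤ i → Commute (r i) x)
    (n : ℕ) : SemiconjBy (r n * r (n + 1)) (conjCopy r s x n) (conjCopy r s x (n + 1)) := by
  have hc := h.commute_conjCopy_of_lt hx (Nat.lt_succ_self n)
  rw [SemiconjBy, conjCopy]
  simp only [mul_assoc, h.inv_mul_assoc, hc.eq]

lemma commute_conjCopy_of_gt (h : BraidFamily k r s) {x : B} (hx : ∀ i, 1 ≤ i → Commute (r i) x)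
    {n i : ℕ} (hin : i + 1 < n) (hn : n < k) : Commute (r i) (conjCopy r s x n) := by
  induction n, hin using Nat.le_induction with
  | base =>
    have h1 := h.semiconj_mul hn
    have hc := h.commute_conjCopy_of_lt hx (Nat.lt_succ_self i)
    have hu : SemiconjBy (r (i + 1) * r i) (r (i + 1)) (r i) := by
      rw [SemiconjBy, ← h.braid i hn, mul_assoc]
    have hui : SemiconjBy (s i * s (i + 1)) (r i) (r (i + 1)) := h.symm.semiconj_mul_inv hn
    have e : conjCopy r s x (i + 2)
        = (r (i + 1) * r i) * conjCopy r s x i * (s i * s (i + 1)) := by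
      simp only [conjCopy, mul_assoc]
    rw [e]
    rw [commute_iff_eq]
    calc r i * (r (i + 1) * r i * conjCopy r s x i * (s i * s (i + 1)))
        = (r i * (r (i + 1) * r i)) * conjCopy r s x i * (s i * s (i + 1)) := by
          simp only [mul_assoc]
      _ = (r (i + 1) * r i) * (r (i + 1) * conjCopy r s x i) * (s i * s (i + 1)) := by
          rw [← hu.eq]; simp only [mul_assoc]
      _ = (r (i + 1) * r i) * conjCopy r s x i * (r (i + 1) * (s i * s (i + 1))) := by
          rw [hc.eq]; simp only [mul_assoc]
      _ = (r (i + 1) * r i) * conjCopy r s x i * (s i * s (i + 1)) * r i := by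
          rw [← hui.eq]; simp only [mul_assoc]
  | succ n hn' ih =>
    have hf : Commute (r i) (r n) := h.far i n hn'
    exact (hf.mul_right (ih (by omega))).mul_right (h.commute_inv hf.symm).symm


/-- A relation at the first sites propagates along the conjugations `r n * r (n + 1)`. -/
lemma eq_of_semiconj (h : BraidFamily k r s) {f g : ℕ → B} (h0 : 1 < k → f 0 = g 0)
    (hf : ∀ n, n + 2 < k → SemiconjBy (r n * r (n + 1)) (f n) (f (n + 1)))
    (hg : ∀ n, n + 2 < k → SemiconjBy (r n * r (n + 1)) (g n) (g (n + 1)))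
    {n : ℕ} (hn : n + 1 < k) : f n = g n := by
  induction n with
  | zero => exact h0 hn
  | succ n ih =>
    refine ((h.isUnit n).mul (h.isUnit (n + 1))).mul_right_cancel ?_
    rw [← (hf n hn).eq, ← (hg n hn).eq, ih (by omega)]

/-- The reflection equation propagates to all copies. -/
lemma reflection_conjCopy (h : BraidFamily k r s) {t : ℕ → B} {x : B}
    (hx : ∀ i, 1 ≤ i → Commute (r i) x)
    (ht : ∀ n, n + 2 < k → SemiconjBy (r n * r (n + 1)) (t n) (t (n + 1)))
    (hre : 1 < k → t 0 * x * t 0 * x = x * t 0 * x * t 0) {n : ℕ} (hn : n + 1 < k) :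
    t n * conjCopy r s x n * t n * conjCopy r s x n =
      conjCopy r s x n * t n * conjCopy r s x n * t n := by
  have hc := h.semiconj_conjCopy hx
  exact h.eq_of_semiconj (f := fun n => t n * conjCopy r s x n * t n * conjCopy r s x n)
    (g := fun n => conjCopy r s x n * t n * conjCopy r s x n * t n) hre
    (fun n hn => (((ht n hn).mul_right (hc n)).mul_right (ht n hn)).mul_right (hc n))
    (fun n hn => (((hc n).mul_right (ht n hn)).mul_right (hc n)).mul_right (ht n hn)) hn

/-- The permutation relation propagates to all copies. -/
lemma permutation_conjCopy (h : BraidFamily k r s) {m d : B}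
    (hm : ∀ i, 1 ≤ i → Commute (r i) m) (hd : ∀ i, 1 ≤ i → Commute (r i) d)
    (hdm : 1 < k → d * r 0 * m * r 0 = r 0 * m * s 0 * d) {n : ℕ} (hn : n + 1 < k) :
    conjCopy r s d n * r n * conjCopy r s m n * r n =
      r n * conjCopy r s m n * s n * conjCopy r s d n := by
  have hcm := h.semiconj_conjCopy hm
  have hcd := h.semiconj_conjCopy hd
  have hr := fun n (hn : n + 2 < k) => h.semiconj_mul hn
  have hs := fun n (hn : n + 2 < k) => h.semiconj_mul_inv hn
  exact h.eq_of_semiconj (f := fun n => conjCopy r s d n * r n * conjCopy r s m n * r n)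
    (g := fun n => r n * conjCopy r s m n * s n * conjCopy r s d n) hdm
    (fun n hn => (((hcd n).mul_right (hr n hn)).mul_right (hcm n)).mul_right (hr n hn))
    (fun n hn => (((hr n hn).mul_right (hcm n)).mul_right (hs n hn)).mul_right (hcd n)) hn

/-- `R_i` commutes with `M_{⟨1→n⟩}` for a solution `M` of the reflection equation. -/
lemma commute_ascProd_conjCopy (h : BraidFamily k r s) {m : B}
    (hm : ∀ i, 1 ≤ i → Commute (r i) m) (hre : 1 < k → r 0 * m * r 0 * m = m * r 0 * m * r 0)
    {i n : ℕ} (hin : i + 1 < n) (hn : n ≤ k) : Commute (r i) (ascProd (conjCopy r s m) n) := by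
  refine commute_ascProd_of_pair _ _ i n hin ?_ fun j hj h1 h2 => ?_
  · have e := h.reflection_conjCopy hm (fun n hn => h.semiconj_mul hn) hre (n := i) (by omega)
    simp only [mul_assoc] at e
    rw [commute_iff_eq, conjCopy]
    calc r i * (conjCopy r s m i * (r i * conjCopy r s m i * s i))
        = (r i * (conjCopy r s m i * (r i * conjCopy r s m i))) * s i := by simp only [mul_assoc]
      _ = conjCopy r s m i * (r i * conjCopy r s m i * s i) * r i := by
          rw [e]; simp only [mul_assoc, h.mul_inv, h.inv_mul]
  · rcases Nat.lt_or_gt_of_ne h1 with h1 | h1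
    · exact h.commute_conjCopy_of_lt hm h1
    · exact h.commute_conjCopy_of_gt hm (by omega) (by omega)

/-- `R_i` commutes with `D_{⟨n→1⟩}` for a solution `D` of the inverse reflection equation. -/
lemma commute_descProd_conjCopy (h : BraidFamily k r s) {d : B}
    (hd : ∀ i, 1 ≤ i → Commute (r i) d) (hre : 1 < k → s 0 * d * s 0 * d = d * s 0 * d * s 0)
    {i n : ℕ} (hin : i + 1 < n) (hn : n ≤ k) : Commute (r i) (descProd (conjCopy r s d) n) := by
  refine commute_descProd_of_pair _ _ i n hin ?_ fun j hj h1 h2 => ?_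
  · have e := h.reflection_conjCopy hd (fun n hn => h.semiconj_mul_inv hn) hre (n := i) (by omega)
    have hs : Commute (s i) (conjCopy r s d i * s i * conjCopy r s d i) := by
      rw [commute_iff_eq, ← e]; simp only [mul_assoc]
    have hr := (Commute.refl (r i)).mul_right (h.commute_of_inv hs)
    rw [conjCopy]
    simpa only [mul_assoc] using hr
  · rcases Nat.lt_or_gt_of_ne h1 with h1 | h1
    · exact h.commute_conjCopy_of_lt hd h1
    · exact h.commute_conjCopy_of_gt hd (by omega) (by omega)

/-- What commutes with the generators `R_1, …, R_n` commutes with `J_{n+1}`. -/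
lemma _root_.commute_jucysMurphy {z : B} {n : ℕ} (hz : ∀ i < n, Commute z (s i)) :
    Commute z (jucysMurphy s n) := by
  induction n with
  | zero => exact Commute.one_right z
  | succ n ih =>
    have hn := hz n n.lt_succ_self
    exact (hn.mul_right (ih fun i hi => hz i (by omega))).mul_right hn

lemma commute_inv_jucysMurphy (h : BraidFamily k r s) {i n : ℕ} (hin : i + 1 < n) (hn : n < k) :
    Commute (s i) (jucysMurphy s n) := by
  induction n, hin using Nat.le_induction with
  | base =>
    have hJ : Commute (s (i + 1)) (jucysMurphy s i) :=
      commute_jucysMurphy fun j hj => (h.symm.far j (i + 1) (by omega)).symm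
    have hb := h.symm.braid i hn
    simp only [mul_assoc] at hb
    rw [commute_iff_eq]
    simp only [jucysMurphy]
    calc s i * (s (i + 1) * (s i * jucysMurphy s i * s i) * s (i + 1))
        = (s i * (s (i + 1) * s i)) * jucysMurphy s i * s i * s (i + 1) := by
          simp only [mul_assoc]
      _ = s (i + 1) * s i * (s (i + 1) * jucysMurphy s i) * s i * s (i + 1) := by
          rw [hb]; simp only [mul_assoc]
      _ = s (i + 1) * s i * jucysMurphy s i * (s (i + 1) * (s i * s (i + 1))) := by
          rw [hJ.eq]; simp only [mul_assoc]
      _ = s (i + 1) * (s i * jucysMurphy s i * s i) * s (i + 1) * s i := by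
          rw [← hb]; simp only [mul_assoc]
  | succ n hn' ih =>
    have hf : Commute (s i) (s n) := h.symm.far i n hn'
    exact (hf.mul_right (ih (by omega))).mul_right hf

/-- What commutes with the generators `R_1, …, R_{n-1}` commutes with `J_1 ⋯ J_n`. -/
lemma _root_.commute_ascProd_jucysMurphy {z : B} {n : ℕ}
    (hz : ∀ i, i + 1 < n → Commute z (s i)) : Commute z (ascProd (jucysMurphy s) n) :=
  commute_ascProd _ _ _ fun _ hj => commute_jucysMurphy fun i hi => hz i (by omega)

/-- `D_{⟨n→1⟩} M_{⟨n+1⟩} = M_{⟨n+1⟩} D_{⟨n→1⟩} J_{n+1}⁻¹`. -/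
lemma descProd_mul_conjCopy (h : BraidFamily k r s) {m d : B}
    (hm : ∀ i, 1 ≤ i → Commute (r i) m) (hd : ∀ i, 1 ≤ i → Commute (r i) d)
    (hdm : 1 < k → d * r 0 * m * r 0 = r 0 * m * s 0 * d) {n : ℕ} (hn : n < k) :
    descProd (conjCopy r s d) n * conjCopy r s m n =
      conjCopy r s m n * (descProd (conjCopy r s d) n * jucysMurphy s n) := by
  induction n with
  | zero => simp [descProd_zero, jucysMurphy]
  | succ n ih =>
    have hr : Commute (r n) (descProd (conjCopy r s d) n) :=
      commute_descProd _ _ _ fun j hj => h.commute_conjCopy_of_lt hd hj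
    have hs := h.commute_inv hr
    have e := h.permutation_conjCopy hm hd hdm hn
    have e' : conjCopy r s d n * r n * conjCopy r s m n =
        r n * conjCopy r s m n * s n * conjCopy r s d n * s n := by
      rw [← e, mul_assoc _ (r n) (s n), h.mul_inv, mul_one]
    rw [descProd_succ]
    simp only [conjCopy, jucysMurphy]
    calc conjCopy r s d n * descProd (conjCopy r s d) n * (r n * conjCopy r s m n * s n)
        = conjCopy r s d n * (descProd (conjCopy r s d) n * r n) * conjCopy r s m n * s n := by
          simp only [mul_assoc]
      _ = conjCopy r s d n * r n * (descProd (conjCopy r s d) n * conjCopy r s m n) * s n := by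
          rw [← hr.eq]; simp only [mul_assoc]
      _ = (conjCopy r s d n * r n * conjCopy r s m n) *
            (descProd (conjCopy r s d) n * jucysMurphy s n) * s n := by
          rw [ih (by omega)]; simp only [mul_assoc]
      _ = r n * conjCopy r s m n * s n * conjCopy r s d n *
            (s n * descProd (conjCopy r s d) n) * jucysMurphy s n * s n := by
          rw [e']; simp only [mul_assoc]
      _ = _ := by rw [hs.eq]; simp only [mul_assoc]

/-- `D_{⟨n→1⟩} J_{n+1}⁻¹ D_{⟨n+1⟩} = D_{⟨n+1→1⟩} J_{n+1}⁻¹`. -/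
lemma descProd_mul_jucysMurphy_mul_conjCopy (h : BraidFamily k r s) {d : B}
    (hd : ∀ i, 1 ≤ i → Commute (r i) d) (hre : 1 < k → s 0 * d * s 0 * d = d * s 0 * d * s 0)
    {n : ℕ} (hn : n < k) :
    descProd (conjCopy r s d) n * jucysMurphy s n * conjCopy r s d n =
      conjCopy r s d n * (descProd (conjCopy r s d) n * jucysMurphy s n) := by
  induction n with
  | zero => simp [descProd_zero, jucysMurphy]
  | succ n ih =>
    have hs : Commute (s n) (descProd (conjCopy r s d) n) :=
      h.commute_inv (commute_descProd _ _ _ fun j hj => h.commute_conjCopy_of_lt hd hj)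
    have e := h.reflection_conjCopy hd (fun n hn => h.semiconj_mul_inv hn) hre hn
    have e' : conjCopy r s d n * s n * conjCopy r s d n =
        r n * conjCopy r s d n * s n * conjCopy r s d n * s n := by
      simp only [mul_assoc] at e ⊢
      rw [← e, h.mul_inv_assoc]
    have ih := ih (by omega)
    rw [descProd_succ]
    simp only [conjCopy, jucysMurphy]
    calc conjCopy r s d n * descProd (conjCopy r s d) n * (s n * jucysMurphy s n * s n) *
          (r n * conjCopy r s d n * s n)
        = conjCopy r s d n * (descProd (conjCopy r s d) n * s n) * jucysMurphy s n *
            conjCopy r s d n * s n := by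
          simp only [mul_assoc, h.inv_mul_assoc]
      _ = conjCopy r s d n * s n *
            (descProd (conjCopy r s d) n * jucysMurphy s n * conjCopy r s d n) * s n := by
          rw [← hs.eq]; simp only [mul_assoc]
      _ = (conjCopy r s d n * s n * conjCopy r s d n) * descProd (conjCopy r s d) n *
            jucysMurphy s n * s n := by
          rw [ih]; simp only [mul_assoc]
      _ = r n * conjCopy r s d n * s n * conjCopy r s d n * (s n * descProd (conjCopy r s d) n) *
            jucysMurphy s n * s n := by
          rw [e']; simp only [mul_assoc]
      _ = _ := by rw [hs.eq]; simp only [mul_assoc]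

lemma conjCopy_mul (h : BraidFamily k r s) (x y : B) (n : ℕ) :
    conjCopy r s (x * y) n = conjCopy r s x n * conjCopy r s y n := by
  induction n with
  | zero => rfl
  | succ n ih => simp only [conjCopy, ih, mul_assoc, h.inv_mul_assoc]

/-- Normal ordering of the product of the copies of `m * d`. -/
theorem ascProd_conjCopy_mul (h : BraidFamily k r s) {m d : B}
    (hm : ∀ i, 1 ≤ i → Commute (r i) m) (hd : ∀ i, 1 ≤ i → Commute (r i) d)
    (hre : 1 < k → s 0 * d * s 0 * d = d * s 0 * d * s 0)
    (hdm : 1 < k → d * r 0 * m * r 0 = r 0 * m * s 0 * d) {n : ℕ} (hn : n ≤ k) :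
    ascProd (conjCopy r s (m * d)) n =
      ascProd (conjCopy r s m) n * descProd (conjCopy r s d) n * ascProd (jucysMurphy s) n := by
  induction n with
  | zero => simp [ascProd_zero, descProd_zero]
  | succ n ih =>
    have hPm : Commute (conjCopy r s m n) (ascProd (jucysMurphy s) n) :=
      commute_ascProd_jucysMurphy fun i hi =>
        (h.commute_inv (h.commute_conjCopy_of_gt hm hi hn)).symm
    have hPd : Commute (conjCopy r s d n) (ascProd (jucysMurphy s) n) :=
      commute_ascProd_jucysMurphy fun i hi =>
        (h.commute_inv (h.commute_conjCopy_of_gt hd hi hn)).symm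
    have hPJ : Commute (jucysMurphy s n) (ascProd (jucysMurphy s) n) :=
      commute_ascProd_jucysMurphy fun i hi => (h.commute_inv_jucysMurphy hi hn).symm
    have e1 := h.descProd_mul_conjCopy hm hd hdm hn
    have e2 := h.descProd_mul_jucysMurphy_mul_conjCopy hd hre hn
    rw [ascProd_succ, ih (by omega), ascProd_succ, ascProd_succ, descProd_succ, h.conjCopy_mul]
    calc ascProd (conjCopy r s m) n * descProd (conjCopy r s d) n * ascProd (jucysMurphy s) n *
          (conjCopy r s m n * conjCopy r s d n)
        = ascProd (conjCopy r s m) n * descProd (conjCopy r s d) n *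
            (ascProd (jucysMurphy s) n * (conjCopy r s m n * conjCopy r s d n)) := by
          simp only [mul_assoc]
      _ = ascProd (conjCopy r s m) n * (descProd (conjCopy r s d) n * conjCopy r s m n) *
            conjCopy r s d n * ascProd (jucysMurphy s) n := by
          rw [← (hPm.mul_left hPd).eq]; simp only [mul_assoc]
      _ = ascProd (conjCopy r s m) n * conjCopy r s m n *
            (descProd (conjCopy r s d) n * jucysMurphy s n * conjCopy r s d n) *
            ascProd (jucysMurphy s) n := by
          rw [e1]; simp only [mul_assoc]
      _ = ascProd (conjCopy r s m) n * conjCopy r s m n * (conjCopy r s d n *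
            descProd (conjCopy r s d) n) * (jucysMurphy s n * ascProd (jucysMurphy s) n) := by
          rw [e2]; simp only [mul_assoc]
      _ = _ := by rw [hPJ.eq]

end BraidFamily

section Embedding

variable {α : Type*} [Semiring α] {N : ℕ}

open Classical in
/-- The operator on `V^{⊗k}` acting as `X` on the sites in the range of `f` and as the identity
on the others. -/
def siteEmb {m k : ℕ} (f : Fin m → Fin k) (X : Matrix (Fin m → Fin N) (Fin m → Fin N) α) :
    Matrix (Fin k → Fin N) (Fin k → Fin N) α :=
  Matrix.of fun a b => if ∀ l ∉ Set.range f, a l = b l then X (a ∘ f) (b ∘ f) else 0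

lemma siteEmb_mul {m k : ℕ} {f : Fin m → Fin k} (hf : Function.Injective f)
    (X Y : Matrix (Fin m → Fin N) (Fin m → Fin N) α) :
    siteEmb f (X * Y) = siteEmb f X * siteEmb f Y := by
  classical
  ext a c
  simp only [siteEmb, Matrix.mul_apply, Matrix.of_apply]
  split_ifs with hac
  · have hz : ∀ b : Fin k → Fin N,
        ((if ∀ l ∉ Set.range f, a l = b l then X (a ∘ f) (b ∘ f) else 0) *
          (if ∀ l ∉ Set.range f, b l = c l then Y (b ∘ f) (c ∘ f) else 0)) =
        if ∀ l ∉ Set.range f, a l = b l then X (a ∘ f) (b ∘ f) * Y (b ∘ f) (c ∘ f) else 0 := by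
      intro b
      by_cases hab : ∀ l ∉ Set.range f, a l = b l
      · rw [if_pos hab, if_pos hab, if_pos fun l hl => (hab l hl).symm.trans (hac l hl)]
      · rw [if_neg hab, if_neg hab, zero_mul]
    simp only [hz]
    rw [← Finset.sum_filter]
    refine Finset.sum_nbij' (fun p => Function.extend f p a) (fun b => b ∘ f) ?_ ?_ ?_ ?_ ?_
    · intro p _
      simp only [Finset.mem_filter, Finset.mem_univ, true_and]
      intro l hl
      rw [Function.extend_apply' _ _ _ hl]
    · simp
    · intro p _
      exact Function.extend_comp hf p a
    · intro b hb
      simp only [Finset.mem_filter, Finset.mem_univ, true_and] at hb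
      funext l
      by_cases hl : l ∈ Set.range f
      · obtain ⟨x, rfl⟩ := hl
        simp [hf.extend_apply]
      · rw [Function.extend_apply' _ _ _ hl, hb l hl]
    · intro p _
      rw [Function.extend_comp hf]
  · refine (Finset.sum_eq_zero fun b _ => ?_).symm
    by_cases hab : ∀ l ∉ Set.range f, a l = b l
    · rw [if_neg (c := ∀ l ∉ Set.range f, b l = c l)
        fun hbc => hac fun l hl => (hab l hl).trans (hbc l hl), mul_zero]
    · rw [if_neg hab, zero_mul]

lemma siteEmb_one {m k : ℕ} (f : Fin m → Fin k) :
    siteEmb f (1 : Matrix (Fin m → Fin N) (Fin m → Fin N) α) = 1 := by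
  classical
  ext a b
  simp only [siteEmb, Matrix.of_apply, Matrix.one_apply]
  by_cases hab : a = b
  · simp [hab]
  · rw [if_neg hab]
    split_ifs with h1 h2
    · refine absurd (funext fun l => ?_) hab
      by_cases hl : l ∈ Set.range f
      · obtain ⟨x, rfl⟩ := hl
        exact congrFun h2 x
      · exact h1 l hl
    · rfl
    · rfl

open Classical in
lemma siteEmb_mul_siteEmb_apply {m n k : ℕ} {f : Fin m → Fin k} {g : Fin n → Fin k}
    (hfg : Disjoint (Set.range f) (Set.range g))
    (X : Matrix (Fin m → Fin N) (Fin m → Fin N) α) (Y : Matrix (Fin n → Fin N) (Fin n → Fin N) α)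
    (a c : Fin k → Fin N) :
    (siteEmb f X * siteEmb g Y) a c =
      if ∀ l, l ∉ Set.range f → l ∉ Set.range g → a l = c l then
        X (a ∘ f) (c ∘ f) * Y (a ∘ g) (c ∘ g) else 0 := by
  simp only [siteEmb, Matrix.mul_apply, Matrix.of_apply]
  rw [Finset.sum_eq_single fun l => if l ∈ Set.range f then c l else a l]
  · have h1 : ∀ l ∉ Set.range f, a l = if l ∈ Set.range f then c l else a l :=
      fun l hl => by rw [if_neg hl]
    have h2 : (fun l => if l ∈ Set.range f then c l else a l) ∘ f = c ∘ f := by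
      funext x; simp
    have h3 : (fun l => if l ∈ Set.range f then c l else a l) ∘ g = a ∘ g := by
      funext x
      exact if_neg (Set.disjoint_right.mp hfg ⟨x, rfl⟩)
    rw [if_pos h1, h2, h3]
    by_cases hac : ∀ l, l ∉ Set.range f → l ∉ Set.range g → a l = c l
    · rw [if_pos hac, if_pos]
      intro l hl
      beta_reduce
      split_ifs with hlf
      · rfl
      · exact hac l hlf hl
    · rw [if_neg hac, if_neg, mul_zero]
      intro h
      refine hac fun l hlf hlg => ?_
      have := h l hlg
      beta_reduce at this
      rwa [if_neg hlf] at this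
  · intro b _ hb
    by_cases hab : ∀ l ∉ Set.range f, a l = b l
    · rw [if_neg (c := ∀ l ∉ Set.range g, b l = c l), mul_zero]
      intro hbc
      refine hb (funext fun l => ?_)
      split_ifs with hlf
      · exact hbc l (Set.disjoint_left.mp hfg hlf)
      · exact (hab l hlf).symm
    · rw [if_neg hab, zero_mul]
  · exact fun h => absurd (Finset.mem_univ _) h

lemma siteEmb_commute {m n k : ℕ} {f : Fin m → Fin k} {g : Fin n → Fin k}
    (hfg : Disjoint (Set.range f) (Set.range g))
    {X : Matrix (Fin m → Fin N) (Fin m → Fin N) α} {Y : Matrix (Fin n → Fin N) (Fin n → Fin N) α}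
    (hXY : ∀ a b c d, Commute (X a b) (Y c d)) : Commute (siteEmb f X) (siteEmb g Y) := by
  ext a c
  rw [siteEmb_mul_siteEmb_apply hfg, siteEmb_mul_siteEmb_apply hfg.symm, (hXY _ _ _ _).eq]
  simp only [forall_comm (α := _ ∉ Set.range f)]

/-- The inclusion of `m` consecutive sites starting at site `i`. -/
def shiftSite {m k : ℕ} (i : ℕ) (h : i + m ≤ k) (l : Fin m) : Fin k := ⟨i + l, by omega⟩

lemma shiftSite_injective {m k : ℕ} (i : ℕ) (h : i + m ≤ k) :
    Function.Injective (shiftSite i h) := by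
  intro a b hab
  simp only [shiftSite, Fin.mk.injEq] at hab
  omega

lemma notMem_range_shiftSite {m k : ℕ} (i : ℕ) (h : i + m ≤ k) (l : Fin k) :
    l ∉ Set.range (shiftSite i h) ↔ (l : ℕ) < i ∨ i + m ≤ l := by
  simp only [Set.mem_range, shiftSite, Fin.ext_iff, not_exists]
  constructor
  · intro H
    by_contra hc
    exact H ⟨l - i, by omega⟩ (by simp only; omega)
  · intro H x
    omega

lemma siteEmb_opAt {m k : ℕ} (i j : ℕ) (h : i + m ≤ k) (hj : j + 1 < m)
    (R : Matrix (Fin N × Fin N) (Fin N × Fin N) α) :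
    siteEmb (shiftSite i h) (opAt N m R j) = opAt N k R (i + j) := by
  ext a b
  have hk : i + j + 1 < k := by omega
  simp only [siteEmb, opAt, dif_pos hj, dif_pos hk, Matrix.of_apply, ← ite_and]
  refine if_congr ?_ rfl rfl
  simp only [notMem_range_shiftSite, Function.comp_apply]
  constructor
  · rintro ⟨h1, h2⟩ l hl1 hl2
    by_cases hl : (l : ℕ) < i ∨ i + m ≤ l
    · exact h1 l hl
    · have := h2 ⟨l - i, by omega⟩ (by simp only; omega) (by simp only; omega)
      have e : shiftSite i h ⟨l - i, by omega⟩ = l := by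
        simp only [shiftSite, Fin.ext_iff]; omega
      rwa [e] at this
  · intro H
    exact ⟨fun l hl => H l (by omega) (by omega),
      fun l h1 h2 => H _ (by simp only [shiftSite]; omega) (by simp only [shiftSite]; omega)⟩

lemma siteEmb_matAt {m k : ℕ} (i j : ℕ) (h : i + m ≤ k) (hj : j < m)
    (X : Matrix (Fin N) (Fin N) α) :
    siteEmb (shiftSite i h) (matAt N m X j) = matAt N k X (i + j) := by
  ext a b
  have hk : i + j < k := by omega
  simp only [siteEmb, matAt, dif_pos hj, dif_pos hk, Matrix.of_apply, ← ite_and]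
  refine if_congr ?_ rfl rfl
  simp only [notMem_range_shiftSite, Function.comp_apply]
  constructor
  · rintro ⟨h1, h2⟩ l hl1
    by_cases hl : (l : ℕ) < i ∨ i + m ≤ l
    · exact h1 l hl
    · have := h2 ⟨l - i, by omega⟩ (by simp only; omega)
      have e : shiftSite i h ⟨l - i, by omega⟩ = l := by
        simp only [shiftSite, Fin.ext_iff]; omega
      rwa [e] at this
  · intro H
    exact ⟨fun l hl => H l (by omega), fun l h1 => H _ (by simp only [shiftSite]; omega)⟩

lemma opAt_two (R : Matrix (Fin N × Fin N) (Fin N × Fin N) α) :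
    opAt N 2 R 0 = R.submatrix (finTwoArrowEquiv _) (finTwoArrowEquiv _) := by
  ext a b
  simp [opAt, finTwoArrowEquiv, Fin.forall_fin_two]

lemma matAt_one (X : Matrix (Fin N) (Fin N) α) :
    matAt N 1 X 0 = X.submatrix (Equiv.funUnique (Fin 1) _) (Equiv.funUnique (Fin 1) _) := by
  ext a b
  simp [matAt]

lemma opAt_mul_eq_one {R S : Matrix (Fin N × Fin N) (Fin N × Fin N) α} (h : R * S = 1)
    (k i : ℕ) : opAt N k R i * opAt N k S i = 1 := by
  by_cases hi : i + 1 < k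
  · rw [← Nat.add_zero i, ← siteEmb_opAt i 0 hi one_lt_two, ← siteEmb_opAt i 0 hi one_lt_two,
      ← siteEmb_mul (shiftSite_injective i hi), opAt_two, opAt_two, Matrix.submatrix_mul_equiv, h,
      Matrix.submatrix_one_equiv, siteEmb_one]
  · simp [opAt, hi]

lemma matAt_mul {k : ℕ} (hk : 1 ≤ k) (X Y : Matrix (Fin N) (Fin N) α) :
    matAt N k (X * Y) 0 = matAt N k X 0 * matAt N k Y 0 := by
  have h : 0 + 1 ≤ k := by omega
  rw [← Nat.add_zero 0, ← siteEmb_matAt 0 0 h one_pos, ← siteEmb_matAt 0 0 h one_pos,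
    ← siteEmb_matAt 0 0 h one_pos, ← siteEmb_mul (shiftSite_injective 0 h), matAt_one, matAt_one,
    matAt_one, Matrix.submatrix_mul_equiv]

end Embedding

section Numeric

variable {A : Type*} [Ring A] [Algebra ℂ A] {N : ℕ}

lemma toA_mul {ι : Type*} [Fintype ι] (X Y : Matrix ι ι ℂ) : toA A (X * Y) = toA A X * toA A Y :=
  Matrix.map_mul

lemma toA_one {ι : Type*} [DecidableEq ι] : toA A (1 : Matrix ι ι ℂ) = 1 :=
  Matrix.map_one _ (map_zero _) (map_one _)

lemma opAt_toA (k i : ℕ) (R : Matrix (Fin N × Fin N) (Fin N × Fin N) ℂ) :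
    opAt N k (toA A R) i = toA A (opAt N k R i) := by
  by_cases hi : i + 1 < k
  · ext a b
    simp only [opAt, toA, dif_pos hi, Matrix.of_apply, Matrix.map_apply]
    split_ifs
    · rfl
    · exact (map_zero _).symm
  · simp [opAt, hi, toA_one]

lemma disjoint_range_shiftSite {m n k i j : ℕ} (hi : i + m ≤ k) (hj : j + n ≤ k)
    (hij : i + m ≤ j) : Disjoint (Set.range (shiftSite i hi)) (Set.range (shiftSite j hj)) := by
  rw [Set.disjoint_right]
  rintro _ ⟨x, rfl⟩
  rw [notMem_range_shiftSite]
  simp only [shiftSite]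
  omega

lemma commute_toA_apply {ι κ : Type*} (X : Matrix ι ι ℂ) (Y : Matrix κ κ A) (a b : ι) (c d : κ) :
    Commute (toA A X a b) (Y c d) :=
  Algebra.commutes _ _

lemma opAt_far (R : Matrix (Fin N × Fin N) (Fin N × Fin N) ℂ) (k i j : ℕ) (hij : i + 2 ≤ j) :
    Commute (opAt N k (toA A R) i) (opAt N k (toA A R) j) := by
  by_cases hj : j + 2 ≤ k
  · have hi : i + 2 ≤ k := by omega
    rw [← Nat.add_zero i, ← Nat.add_zero j, ← siteEmb_opAt i 0 hi one_lt_two,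
      ← siteEmb_opAt j 0 hj one_lt_two]
    refine siteEmb_commute (disjoint_range_shiftSite hi hj hij) ?_
    rw [opAt_toA 2]
    exact commute_toA_apply _ _
  · have : opAt N k (toA A R) j = 1 := dif_neg (by omega)
    rw [this]
    exact Commute.one_right _

lemma opAt_commute_matAt (R : Matrix (Fin N × Fin N) (Fin N × Fin N) ℂ)
    (X : Matrix (Fin N) (Fin N) A) (k i : ℕ) (hi : 1 ≤ i) :
    Commute (opAt N k (toA A R) i) (matAt N k X 0) := by
  by_cases hik : i + 2 ≤ k
  · have h0 : 0 + 1 ≤ k := by omega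
    have e := siteEmb_matAt 0 0 h0 one_pos X
    rw [Nat.add_zero] at e
    rw [← e, ← Nat.add_zero i, ← siteEmb_opAt i 0 hik one_lt_two]
    refine siteEmb_commute (disjoint_range_shiftSite h0 hik (by omega)).symm ?_
    rw [opAt_toA 2]
    exact commute_toA_apply _ _
  · have : opAt N k (toA A R) i = 1 := dif_neg (by omega)
    rw [this]
    exact Commute.one_left _

lemma opAt_braid {R : Matrix (Fin N × Fin N) (Fin N × Fin N) ℂ} (h : IsBraid N R) (k i : ℕ)
    (hi : i + 3 ≤ k) :
    opAt N k (toA A R) i * opAt N k (toA A R) (i + 1) * opAt N k (toA A R) i =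
      opAt N k (toA A R) (i + 1) * opAt N k (toA A R) i * opAt N k (toA A R) (i + 1) := by
  have h3 := congrArg (fun X => siteEmb (shiftSite i hi) (toA A X)) h
  simp only [toA_mul, ← opAt_toA, siteEmb_mul (shiftSite_injective i hi)] at h3
  rw [siteEmb_opAt i 0 hi (by omega), siteEmb_opAt i 1 hi (by omega)] at h3
  exact h3

end Numeric

section Copies

variable {α : Type*} [Semiring α] {N : ℕ}

lemma ovCopy_eq_conjCopy (k : ℕ) (R S : Matrix (Fin N × Fin N) (Fin N × Fin N) α)
    (X : Matrix (Fin N) (Fin N) α) :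
    ovCopy N k R S X = conjCopy (opAt N k R) (opAt N k S) (matAt N k X 0) := by
  funext n
  induction n with
  | zero => rfl
  | succ n ih => rw [ovCopy, ih, conjCopy]

lemma JMup_eq_jucysMurphy (k : ℕ) (R : Matrix (Fin N × Fin N) (Fin N × Fin N) α) :
    (fun n => JMup N k R 0 n) = jucysMurphy (opAt N k R) := by
  funext n
  induction n with
  | zero => rfl
  | succ n ih => rw [JMup, ih, jucysMurphy, Nat.zero_add]

lemma siteEmb_opAt_zero {k : ℕ} (hk : 0 + 2 ≤ k)
    (S : Matrix (Fin N × Fin N) (Fin N × Fin N) α) :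
    siteEmb (shiftSite 0 hk) (opAt N 2 S 0) = opAt N k S 0 :=
  siteEmb_opAt 0 0 hk one_lt_two S

lemma siteEmb_matAt_zero {k : ℕ} (hk : 0 + 2 ≤ k) (X : Matrix (Fin N) (Fin N) α) :
    siteEmb (shiftSite 0 hk) (matAt N 2 X 0) = matAt N k X 0 :=
  siteEmb_matAt 0 0 hk two_pos X

lemma RErel.opAt_mul_matAt {S : Matrix (Fin N × Fin N) (Fin N × Fin N) α}
    {X : Matrix (Fin N) (Fin N) α} (h : RErel N S X) {k : ℕ} (hk : 1 < k) :
    opAt N k S 0 * matAt N k X 0 * opAt N k S 0 * matAt N k X 0 =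
      matAt N k X 0 * opAt N k S 0 * matAt N k X 0 * opAt N k S 0 := by
  have hk' : 0 + 2 ≤ k := hk
  have e := congrArg (siteEmb (shiftSite 0 hk')) h
  simpa only [siteEmb_mul (shiftSite_injective 0 hk'), siteEmb_opAt_zero,
    siteEmb_matAt_zero] using e

end Copies

section HeckeSymmetry

variable {A : Type*} [Ring A] [Algebra ℂ A] {N : ℕ}
  {R Rinv : Matrix (Fin N × Fin N) (Fin N × Fin N) ℂ}

lemma braidFamily_opAt (hRinv : R * Rinv = 1 ∧ Rinv * R = 1) (hbraid : IsBraid N R) (k : ℕ) :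
    BraidFamily k (opAt N k (toA A R)) (opAt N k (toA A Rinv)) where
  mul_inv := opAt_mul_eq_one (by rw [← toA_mul, hRinv.1, toA_one]) k
  inv_mul := opAt_mul_eq_one (by rw [← toA_mul, hRinv.2, toA_one]) k
  far := opAt_far R k
  braid := opAt_braid hbraid k

lemma PermRelHom.matAt_mul_opAt {M D : Matrix (Fin N) (Fin N) A} (h : PermRelHom N R Rinv M D)
    {k : ℕ} (hk : 1 < k) :
    matAt N k D 0 * opAt N k (toA A R) 0 * matAt N k M 0 * opAt N k (toA A R) 0 =
      opAt N k (toA A R) 0 * matAt N k M 0 * opAt N k (toA A Rinv) 0 * matAt N k D 0 := by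
  have hk' : 0 + 2 ≤ k := hk
  have e := congrArg (siteEmb (shiftSite 0 hk')) h
  simpa only [siteEmb_mul (shiftSite_injective 0 hk'), siteEmb_opAt_zero,
    siteEmb_matAt_zero] using e

end HeckeSymmetry

/-- Under the homogeneous permutation relation
`D₁ R M₁ R = R M₁ R⁻¹ D₁`, with `L̂ = MD`, for every `k ≥ 1`:
`L̂_{⟨1→k⟩} = M_{⟨1→k⟩} D_{⟨k→1⟩} ∏_{s=1}^{k} J_s⁻¹ = (∏_{s=1}^{k} J_s⁻¹) M_{⟨1→k⟩} D_{⟨k→1⟩}`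
(the normally ordered form `:L̂_{⟨1→k⟩}:`). -/
theorem stmt13 {A : Type*} [Ring A] [Algebra ℂ A] (N : ℕ) (hN : 1 ≤ N) (q : ℂ)
    (hq : GenericQ q)
    (R Rinv : Matrix (Fin N × Fin N) (Fin N × Fin N) ℂ)
    (hRinv : R * Rinv = 1 ∧ Rinv * R = 1)
    (hbraid : IsBraid N R) (hHecke : IsHecke N q R)
    (M D : Matrix (Fin N) (Fin N) A)
    (hM : RErel N (toA A R) M)
    (hD : RErel N (toA A Rinv) D)
    (hDM : PermRelHom N R Rinv M D)
    (k : ℕ) (hk : 1 ≤ k) :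
    ovProd N k (toA A R) (toA A Rinv) (M * D) k =
        ovProd N k (toA A R) (toA A Rinv) M k *
          ovProdRev N k (toA A R) (toA A Rinv) D k *
          ((List.range k).map (fun s => JMup N k (toA A Rinv) 0 s)).prod ∧
      ovProd N k (toA A R) (toA A Rinv) (M * D) k =
        ((List.range k).map (fun s => JMup N k (toA A Rinv) 0 s)).prod *
          (ovProd N k (toA A R) (toA A Rinv) M k *
            ovProdRev N k (toA A R) (toA A Rinv) D k) := by
  have h := braidFamily_opAt (A := A) hRinv hbraid k
  have hm := opAt_commute_matAt R M k
  have hd := opAt_commute_matAt R D k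
  have hreM := hM.opAt_mul_matAt (k := k)
  have hreD := hD.opAt_mul_matAt (k := k)
  have key := h.ascProd_conjCopy_mul hm hd hreD hDM.matAt_mul_opAt le_rfl
  rw [← matAt_mul hk] at key
  simp only [ovProd, ovProdRev, ovCopy_eq_conjCopy, JMup_eq_jucysMurphy]
  refine ⟨key, key.trans ?_⟩
  refine commute_ascProd_jucysMurphy fun i hi => (h.commute_inv ?_).symm
  exact (h.commute_ascProd_conjCopy hm hreM hi le_rfl).mul_right
    (h.commute_descProd_conjCopy hd hreD hi le_rfl)
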